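/- For every ε₀ ∈ (0, 1/2) there exists a constant C = C(ε₀) ∈ (0, ∞) such that for all ε ∈ (0, ε₀] and all x ≥ 0, |R_ε(x) − R_0(x)| ≤ C·ε. -/

import Mathlib

/-- The Macdonald function (modified Bessel function of the second kind):
`K_ν(x) = (x^ν / 2^(ν+1)) ∫_0^∞ exp(−t − x²/(4t)) t^(−ν−1) dt` for `x > 0`. -/
noncomputable def besselK (ν x : ℝ) : ℝ :=
  x ^ ν / 2 ^ (ν + 1) *
    ∫ t in Set.Ioi (0 : ℝ), Real.exp (-t - x ^ 2 / (4 * t)) * t ^ (-ν - 1)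

/-- `R_α(x) = α + x·K_{1−α}(x)/K_α(x)` for `x > 0`, and `R_α(0) = α`. -/
noncomputable def besselR (α x : ℝ) : ℝ :=
  if x = 0 then α else α + x * besselK (1 - α) x / besselK α x

open Real MeasureTheory Set

lemma sq_div_four_le_cosh (u : ℝ) : u ^ 2 / 4 ≤ cosh u := by
  have h := quadratic_le_exp_of_nonneg (abs_nonneg u)
  have h' := exp_pos (-|u|)
  rw [sq_abs] at h
  rw [← cosh_abs, cosh_eq]
  linarith [abs_nonneg u]

lemma integrable_exp_neg_mul_cosh_mul_exp {x : ℝ} (hx : 0 < x) (a : ℝ) :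
    Integrable fun u : ℝ => exp (-x * cosh u) * exp (a * u) := by
  refine ((integrable_exp_neg_mul_sq (b := x / 8) (by positivity)).const_mul
    (exp (2 * a ^ 2 / x))).mono' (by fun_prop) (.of_forall fun u => ?_)
  rw [norm_of_nonneg (by positivity), ← exp_add, ← exp_add, exp_le_exp]
  have h₁ := mul_le_mul_of_nonneg_left (sq_div_four_le_cosh u) hx.le
  have h₂ : 2 * a ^ 2 / x + x / 8 * u ^ 2 - a * u = (4 * a - x * u) ^ 2 / (8 * x) := by
    field_simp
    ring
  have h₃ : 0 ≤ (4 * a - x * u) ^ 2 / (8 * x) := by positivity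
  linarith

lemma integrable_exp_neg_mul_cosh_mul_cosh {x : ℝ} (hx : 0 < x) (a : ℝ) :
    Integrable fun u : ℝ => exp (-x * cosh u) * cosh (a * u) := by
  refine (((integrable_exp_neg_mul_cosh_mul_exp hx a).add
    (integrable_exp_neg_mul_cosh_mul_exp hx (-a))).div_const 2).congr (.of_forall fun u => ?_)
  simp only [Pi.add_apply, cosh_eq (a * u), neg_mul]
  ring

lemma integrable_exp_neg_mul_cosh_mul_sinh {x : ℝ} (hx : 0 < x) (a : ℝ) :
    Integrable fun u : ℝ => exp (-x * cosh u) * sinh (a * u) := by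
  refine (((integrable_exp_neg_mul_cosh_mul_exp hx a).sub
    (integrable_exp_neg_mul_cosh_mul_exp hx (-a))).div_const 2).congr (.of_forall fun u => ?_)
  simp only [Pi.sub_apply, sinh_eq (a * u), neg_mul]
  ring

lemma integrable_exp_neg_mul_cosh_mul_cosh_mul_cosh {x : ℝ} (hx : 0 < x) (a : ℝ) :
    Integrable fun u : ℝ => exp (-x * cosh u) * (cosh u * cosh (a * u)) := by
  refine (((integrable_exp_neg_mul_cosh_mul_cosh hx (1 + a)).add
    (integrable_exp_neg_mul_cosh_mul_cosh hx (1 - a))).div_const 2).congr (.of_forall fun u => ?_)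
  simp only [Pi.add_apply, add_mul, sub_mul, one_mul, cosh_add, cosh_sub]
  ring

lemma integrable_exp_neg_mul_cosh_mul_sinh_mul_sinh {x : ℝ} (hx : 0 < x) (a : ℝ) :
    Integrable fun u : ℝ => exp (-x * cosh u) * (sinh u * sinh (a * u)) := by
  refine (((integrable_exp_neg_mul_cosh_mul_cosh hx (1 + a)).sub
    (integrable_exp_neg_mul_cosh_mul_cosh hx (1 - a))).div_const 2).congr (.of_forall fun u => ?_)
  simp only [Pi.sub_apply, add_mul, sub_mul, one_mul, cosh_add, cosh_sub]
  ring

lemma image_const_mul_exp_univ {c : ℝ} (hc : 0 < c) :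
    (fun u : ℝ => c * exp u) '' univ = Ioi 0 := by
  ext t
  simp only [image_univ, mem_range, mem_Ioi]
  constructor
  · rintro ⟨u, rfl⟩
    positivity
  · intro ht
    refine ⟨log (t / c), ?_⟩
    rw [exp_log (by positivity)]
    field_simp

/-- Exponential form of the Macdonald function. -/
lemma besselK_eq_integral_exp {x : ℝ} (hx : 0 < x) (ν : ℝ) :
    besselK ν x = (∫ u : ℝ, exp (-x * cosh u) * exp (-ν * u)) / 2 := by
  have hc : 0 < x / 2 := by positivity
  have key := integral_image_eq_integral_abs_deriv_smul (s := univ)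
    (f := fun u : ℝ => x / 2 * exp u) (f' := fun u => x / 2 * exp u) MeasurableSet.univ
    (fun u _ => ((hasDerivAt_exp u).const_mul (x / 2)).hasDerivWithinAt)
    (fun u _ v _ h => exp_injective (mul_left_cancel₀ hc.ne' h))
    (fun t => exp (-t - x ^ 2 / (4 * t)) * t ^ (-ν - 1))
  rw [image_const_mul_exp_univ hc, setIntegral_univ] at key
  rw [besselK, key, ← integral_const_mul, ← integral_div]
  refine integral_congr_ae (.of_forall fun u => ?_)
  simp only [smul_eq_mul]
  have h₁ : -(x / 2 * exp u) - x ^ 2 / (4 * (x / 2 * exp u)) = -x * cosh u := by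
    rw [cosh_eq, exp_neg]
    field_simp
    ring
  have h₂ : x / 2 * exp u * (x / 2 * exp u) ^ (-ν - 1) = (x / 2) ^ (-ν) * exp (-ν * u) := by
    rw [rpow_sub_one (by positivity), mul_div_cancel₀ _ (by positivity),
      mul_rpow hc.le (exp_pos u).le, ← exp_mul, mul_comm u]
  have h₃ : x ^ ν / 2 ^ (ν + 1) * (x / 2) ^ (-ν) = 1 / 2 := by
    rw [rpow_neg hc.le, div_rpow hx.le (by norm_num), rpow_add_one (by norm_num)]
    have := rpow_pos_of_pos hx ν
    have : (0 : ℝ) < 2 ^ ν := by positivity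
    field_simp
  rw [h₁, abs_of_pos (by positivity)]
  calc _ = x ^ ν / 2 ^ (ν + 1) * (x / 2 * exp u * (x / 2 * exp u) ^ (-ν - 1))
        * exp (-x * cosh u) := by ring
    _ = (x ^ ν / 2 ^ (ν + 1) * (x / 2) ^ (-ν)) * exp (-ν * u) * exp (-x * cosh u) := by
      rw [h₂]; ring
    _ = _ := by rw [h₃]; ring

/-- Hyperbolic form of the Macdonald function. -/
lemma besselK_eq_integral_cosh {x : ℝ} (hx : 0 < x) (ν : ℝ) :
    besselK ν x = (∫ u : ℝ, exp (-x * cosh u) * cosh (ν * u)) / 2 := by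
  have hreflect : ∫ u : ℝ, exp (-x * cosh u) * exp (ν * u) =
      ∫ u : ℝ, exp (-x * cosh u) * exp (-ν * u) := by
    rw [← integral_neg_eq_self]
    simp
  have hcosh : ∫ u : ℝ, exp (-x * cosh u) * cosh (ν * u) =
      ((∫ u : ℝ, exp (-x * cosh u) * exp (ν * u)) +
        ∫ u : ℝ, exp (-x * cosh u) * exp (-ν * u)) / 2 := by
    rw [← integral_add (integrable_exp_neg_mul_cosh_mul_exp hx ν)
      (integrable_exp_neg_mul_cosh_mul_exp hx (-ν)), ← integral_div]
    refine integral_congr_ae (.of_forall fun u => ?_)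
    simp only [cosh_eq (ν * u), neg_mul]
    ring
  rw [besselK_eq_integral_exp hx, hcosh, hreflect]
  ring

lemma besselK_pos {x : ℝ} (hx : 0 < x) (ν : ℝ) : 0 < besselK ν x := by
  rw [besselK_eq_integral_cosh hx]
  refine half_pos ((integral_pos_iff_support_of_nonneg (fun u => ?_)
    (integrable_exp_neg_mul_cosh_mul_cosh hx ν)).2 ?_)
  · exact (mul_pos (exp_pos _) (cosh_pos _)).le
  · have : Function.support (fun u : ℝ => exp (-x * cosh u) * cosh (ν * u)) = univ :=
      Function.support_eq_univ (fun u => (mul_pos (exp_pos _) (cosh_pos _)).ne')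
    rw [this]
    simp

lemma besselK_le_besselK {x μ ν : ℝ} (hx : 0 < x) (h : |μ| ≤ |ν|) :
    besselK μ x ≤ besselK ν x := by
  rw [besselK_eq_integral_cosh hx, besselK_eq_integral_cosh hx]
  refine div_le_div_of_nonneg_right (integral_mono (integrable_exp_neg_mul_cosh_mul_cosh hx μ)
    (integrable_exp_neg_mul_cosh_mul_cosh hx ν) fun u => ?_) (by norm_num)
  refine mul_le_mul_of_nonneg_left (cosh_le_cosh.2 ?_) (exp_pos _).le
  rw [abs_mul, abs_mul]
  gcongr

/-- Integration by parts behind the three-term recurrence for the Macdonald function. -/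
lemma mul_integral_sinh_mul_sinh {x : ℝ} (hx : 0 < x) (ν : ℝ) :
    x * ∫ u : ℝ, exp (-x * cosh u) * (sinh u * sinh (ν * u)) =
      ν * ∫ u : ℝ, exp (-x * cosh u) * cosh (ν * u) := by
  have hint₁ := (integrable_exp_neg_mul_cosh_mul_cosh hx ν).const_mul ν
  have hint₂ := (integrable_exp_neg_mul_cosh_mul_sinh_mul_sinh hx ν).const_mul x
  have h := integral_eq_zero_of_hasDerivAt_of_integrable
    (f := fun u : ℝ => exp (-x * cosh u) * sinh (ν * u)) (fun u => ?_) (hint₁.sub hint₂)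
    (integrable_exp_neg_mul_cosh_mul_sinh hx ν)
  · rw [integral_sub' hint₁ hint₂, integral_const_mul, integral_const_mul] at h
    linarith
  · have h₁ := ((hasDerivAt_cosh u).const_mul (-x)).exp
    have h₂ := ((hasDerivAt_id u).const_mul ν).sinh
    refine (h₁.mul h₂).congr_deriv ?_
    simp only [Pi.sub_apply, id]
    ring

/-- Closed form of the logarithmic derivative `-x K_ν'(x) / K_ν(x)`. -/
lemma besselR_eq_integral {x : ℝ} (hx : 0 < x) (ν : ℝ) :
    besselR ν x =
      x * ((∫ u : ℝ, exp (-x * cosh u) * (cosh u * cosh (ν * u))) / 2) / besselK ν x := by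
  have hK := besselK_pos hx ν
  have hrec := mul_integral_sinh_mul_sinh hx ν
  have hsub : ∫ u : ℝ, exp (-x * cosh u) * cosh ((1 - ν) * u) =
      (∫ u : ℝ, exp (-x * cosh u) * (cosh u * cosh (ν * u))) -
        ∫ u : ℝ, exp (-x * cosh u) * (sinh u * sinh (ν * u)) := by
    rw [← integral_sub (integrable_exp_neg_mul_cosh_mul_cosh_mul_cosh hx ν)
      (integrable_exp_neg_mul_cosh_mul_sinh_mul_sinh hx ν)]
    refine integral_congr_ae (.of_forall fun u => ?_)
    simp only [sub_mul, one_mul, cosh_sub]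
    ring
  have hKν := besselK_eq_integral_cosh hx ν
  rw [besselR, if_neg hx.ne', besselK_eq_integral_cosh hx (1 - ν), hsub, eq_div_iff hK.ne',
    add_mul, div_mul_cancel₀ _ hK.ne', hKν]
  linarith

lemma cosh_sub_mul_cosh_sub_nonneg (a c u : ℝ) :
    0 ≤ (cosh u - cosh c) * (cosh (a * u) - cosh (a * c)) := by
  rcases le_total |u| |c| with h | h
  · refine mul_nonneg_of_nonpos_of_nonpos (sub_nonpos.2 (cosh_le_cosh.2 h))
      (sub_nonpos.2 (cosh_le_cosh.2 ?_))
    rw [abs_mul, abs_mul]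
    gcongr
  · refine mul_nonneg (sub_nonneg.2 (cosh_le_cosh.2 h)) (sub_nonneg.2 (cosh_le_cosh.2 ?_))
    rw [abs_mul, abs_mul]
    gcongr

/-- Chebyshev's association inequality for `cosh u` and `cosh (ν u)` under the weight
`exp (-x cosh u)`. -/
lemma besselK_one_mul_le {x : ℝ} (hx : 0 < x) (ν : ℝ) :
    besselK 1 x * besselK ν x ≤
      (∫ u : ℝ, exp (-x * cosh u) * (cosh u * cosh (ν * u))) / 2 * besselK 0 x := by
  have hK := besselK_pos hx 0
  set a := besselK 1 x / besselK 0 x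
  have ha₁ : 1 ≤ a := (one_le_div hK).2 (besselK_le_besselK hx (by simp))
  have haK : a * besselK 0 x = besselK 1 x := div_mul_cancel₀ _ hK.ne'
  set b := cosh (ν * arcosh a)
  have hP := integrable_exp_neg_mul_cosh_mul_cosh_mul_cosh hx ν
  have hν := (integrable_exp_neg_mul_cosh_mul_cosh hx ν).const_mul a
  have h₁ := (integrable_exp_neg_mul_cosh_mul_cosh hx 1).const_mul b
  have h₀ := (integrable_exp_neg_mul_cosh_mul_cosh hx 0).const_mul (a * b)
  have hnonneg : 0 ≤ ∫ u : ℝ, (exp (-x * cosh u) * (cosh u * cosh (ν * u)) -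
      a * (exp (-x * cosh u) * cosh (ν * u))) - (b * (exp (-x * cosh u) * cosh (1 * u)) -
      a * b * (exp (-x * cosh u) * cosh (0 * u))) := by
    refine integral_nonneg fun u => ?_
    have h := mul_nonneg (exp_pos (-x * cosh u)).le
      (cosh_sub_mul_cosh_sub_nonneg ν (arcosh a) u)
    rw [cosh_arcosh ha₁] at h
    simp only [Pi.zero_apply, one_mul, zero_mul, cosh_zero, mul_one]
    linarith
  rw [integral_sub (by exact hP.sub hν) (by exact h₁.sub h₀), integral_sub hP hν, integral_sub h₁ h₀,
    integral_const_mul, integral_const_mul, integral_const_mul] at hnonneg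
  have hcancel : b * besselK 1 x = a * b * besselK 0 x := by rw [← haK]; ring
  have hle : a * besselK ν x ≤
      (∫ u : ℝ, exp (-x * cosh u) * (cosh u * cosh (ν * u))) / 2 := by
    rw [besselK_eq_integral_cosh hx 1, besselK_eq_integral_cosh hx 0] at hcancel
    rw [besselK_eq_integral_cosh hx ν]
    linarith
  calc besselK 1 x * besselK ν x = a * besselK ν x * besselK 0 x := by rw [← haK]; ring
    _ ≤ _ := mul_le_mul_of_nonneg_right hle hK.le

lemma besselR_zero_le {x : ℝ} (hx : 0 < x) (ν : ℝ) : besselR 0 x ≤ besselR ν x := by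
  rw [besselR_eq_integral hx ν, besselR, if_neg hx.ne', sub_zero, zero_add,
    div_le_div_iff₀ (besselK_pos hx 0) (besselK_pos hx ν), mul_assoc, mul_assoc]
  exact mul_le_mul_of_nonneg_left (besselK_one_mul_le hx ν) hx.le

lemma besselR_le_add {x ν : ℝ} (hx : 0 < x) (hν₀ : 0 ≤ ν) (hν₁ : ν ≤ 1) :
    besselR ν x ≤ ν + besselR 0 x := by
  rw [besselR, besselR, if_neg hx.ne', if_neg hx.ne', sub_zero, zero_add]
  have hone : besselK (1 - ν) x ≤ besselK 1 x :=
    besselK_le_besselK hx (by rw [abs_of_nonneg (by linarith), abs_one]; linarith)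
  have hzero : besselK 0 x ≤ besselK ν x := besselK_le_besselK hx (by simp)
  have := besselK_pos hx 0
  have := besselK_pos hx 1
  gcongr

/-- For every `ε₀ ∈ (0, 1/2)` there is `C = C(ε₀) ∈ (0, ∞)` such that for all
`ε ∈ (0, ε₀]` and all `x ≥ 0`, `|R_ε(x) − R_0(x)| ≤ C·ε`. -/
theorem besselR_modulus_of_continuity (ε₀ : ℝ) (h0 : 0 < ε₀) (h1 : ε₀ < 1 / 2) :
    ∃ C : ℝ, 0 < C ∧
      ∀ ε x : ℝ, 0 < ε → ε ≤ ε₀ → 0 ≤ x → |besselR ε x - besselR 0 x| ≤ C * ε := by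
  refine ⟨1, one_pos, fun ε x hε hε₀ hx => ?_⟩
  rcases hx.eq_or_lt with rfl | hx
  · simp [besselR, abs_of_pos hε]
  · rw [abs_of_nonneg (sub_nonneg.2 (besselR_zero_le hx ε))]
    linarith [besselR_le_add hx hε.le (by linarith)]
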